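/- Let μ be an l-multipartition of d and T a row-strict μ-tableau which is not standard. Then there exist a row Garnir node A of μ and w ∈ S_d such that T = w G^A and ℓ(w^T) = ℓ(w^{G^A}) + ℓ(w), where G^A is the A-Garnir tableau. -/

import Mathlib

noncomputable section

open Equiv

/-! ## Symmetric group combinatorics: words, length, Bruhat order -/

/-- The adjacent transposition `(r, r+1)` (0-indexed) in `S_d`, or `1` if out of range. -/
def stp (d r : ℕ) : Equiv.Perm (Fin d) :=
  if h : r + 1 < d then Equiv.swap ⟨r, Nat.lt_of_succ_lt h⟩ ⟨r + 1, h⟩ else 1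

/-- The transposition `(x, y)` in `S_d`, or `1` if out of range. -/
def swapN (d x y : ℕ) : Equiv.Perm (Fin d) :=
  if hx : x < d then if hy : y < d then Equiv.swap ⟨x, hx⟩ ⟨y, hy⟩ else 1 else 1

/-- The product `s_{r_1} ⋯ s_{r_m}` of the word `l = [r_1, …, r_m]`. -/
def wordProd (d : ℕ) (l : List ℕ) : Equiv.Perm (Fin d) := (l.map (stp d)).prod

/-- A word in the Coxeter generators of `S_d` (0-indexed letters). -/
def IsWord (d : ℕ) (l : List ℕ) : Prop := ∀ r ∈ l, r + 1 < d

/-- Coxeter length in `S_d`. -/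
def len (d : ℕ) (w : Equiv.Perm (Fin d)) : ℕ :=
  sInf {n | ∃ lw, IsWord d lw ∧ lw.length = n ∧ wordProd d lw = w}

/-- `lw` is a reduced decomposition of `w`. -/
def IsReducedWord (d : ℕ) (w : Equiv.Perm (Fin d)) (lw : List ℕ) : Prop :=
  IsWord d lw ∧ wordProd d lw = w ∧ lw.length = len d w

/-- A single commutation (braid) move `… r t … ↦ … t r …` with `|r − t| > 1`. -/
def CommMove (l₁ l₂ : List ℕ) : Prop :=
  ∃ (a b : List ℕ) (r t : ℕ), (r + 2 ≤ t ∨ t + 2 ≤ r) ∧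
    l₁ = a ++ r :: t :: b ∧ l₂ = a ++ t :: r :: b

/-- `w` is fully commutative: any two reduced decompositions are connected by
commutation moves. -/
def FullyCommutative (d : ℕ) (w : Equiv.Perm (Fin d)) : Prop :=
  ∀ l₁ l₂, IsReducedWord d w l₁ → IsReducedWord d w l₂ →
    Relation.ReflTransGen CommMove l₁ l₂

/-- Bruhat order on `S_d` (via the subword property). -/
def Bruhat (d : ℕ) (u w : Equiv.Perm (Fin d)) : Prop :=
  ∃ lw, IsReducedWord d w lw ∧ ∃ lu, lu.Sublist lw ∧ wordProd d lu = u

/-- Strict Bruhat order. -/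
def BruhatLt (d : ℕ) (u w : Equiv.Perm (Fin d)) : Prop := Bruhat d u w ∧ u ≠ w

/-- The parabolic subgroup `S_s × S_{k−s}` of `S_k`:
generated by the `s_r` (1-indexed `r`) with `r ≠ s`. -/
def parab2 (k s : ℕ) : Subgroup (Equiv.Perm (Fin k)) :=
  Subgroup.closure {w | ∃ r, r + 1 < k ∧ r + 1 ≠ s ∧ w = stp k r}

/-- `w` has minimal length in its left coset `w H`. -/
def IsMinCosetRep (k : ℕ) (H : Subgroup (Equiv.Perm (Fin k))) (w : Equiv.Perm (Fin k)) : Prop :=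
  ∀ u ∈ H, len k w ≤ len k (w * u)

/-- Minimal length left coset representatives of `S_f × S_{k−f}` in `S_k`. -/
def Dfk (k f : ℕ) : Set (Equiv.Perm (Fin k)) := {u | IsMinCosetRep k (parab2 k f) u}

open Classical in
/-- Minimal length left coset representatives of `S_f × S_{k−f}` in `S_k`, as a finset. -/
def DfkFinset (k f : ℕ) : Finset (Equiv.Perm (Fin k)) :=
  Finset.univ.filter (fun u => u ∈ Dfk k f)

/-! ## Multipartitions and tableaux -/

/-- A node `(a, b, m)`: row `a`, column `b` (0-indexed), component `m`. -/
abbrev Node (l : ℕ) := ℕ × ℕ × Fin l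

/-- An `l`-multipartition of `d`, recorded by its row lengths. -/
structure MPar (l d : ℕ) where
  part : Fin l → ℕ → ℕ
  anti : ∀ m, ∀ ⦃a b : ℕ⦄, a ≤ b → part m b ≤ part m a
  supp : ∀ m a, d ≤ a → part m a = 0
  size : (∑ m : Fin l, ∑ a ∈ Finset.range d, part m a) = d

variable {l d : ℕ}

/-- Membership of a node in (the Young diagram of) `μ`. -/
def MPar.mem (μ : MPar l d) (x : Node l) : Prop := x.2.1 < μ.part x.2.2 x.1

/-- The nodes of `μ` as a subtype. -/
abbrev MPar.NodeIn (μ : MPar l d) := {x : Node l // μ.mem x}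

/-- A `μ`-tableau: a bijection from the nodes of `μ` to `{0, …, d−1}`. -/
abbrev MPar.Tab (μ : MPar l d) := μ.NodeIn ≃ Fin d

/-- Row-reading order on nodes. -/
def rowLt (x y : Node l) : Prop :=
  x.2.2 < y.2.2 ∨ (x.2.2 = y.2.2 ∧ (x.1 < y.1 ∨ (x.1 = y.1 ∧ x.2.1 < y.2.1)))

/-- Column-reading order on nodes (components in reversed order). -/
def colLt (x y : Node l) : Prop :=
  y.2.2 < x.2.2 ∨ (x.2.2 = y.2.2 ∧ (x.2.1 < y.2.1 ∨ (x.2.1 = y.2.1 ∧ x.1 < y.1)))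

/-- `T` is the row-reading tableau `T^μ`. -/
def MPar.IsRowReading (μ : MPar l d) (T : μ.Tab) : Prop :=
  ∀ x y : μ.NodeIn, rowLt x.1 y.1 → T x < T y

/-- `T` is the column-reading tableau `T_μ`. -/
def MPar.IsColReading (μ : MPar l d) (T : μ.Tab) : Prop :=
  ∀ x y : μ.NodeIn, colLt x.1 y.1 → T x < T y

/-- Row-strict tableau: entries increase along rows. -/
def MPar.RowStrict (μ : MPar l d) (T : μ.Tab) : Prop :=
  ∀ x y : μ.NodeIn, x.1.1 = y.1.1 → x.1.2.2 = y.1.2.2 → x.1.2.1 < y.1.2.1 → T x < T y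

/-- Column-strict tableau: entries increase down columns. -/
def MPar.ColStrict (μ : MPar l d) (T : μ.Tab) : Prop :=
  ∀ x y : μ.NodeIn, x.1.2.1 = y.1.2.1 → x.1.2.2 = y.1.2.2 → x.1.1 < y.1.1 → T x < T y

/-- Standard tableau. -/
def MPar.IsStandard (μ : MPar l d) (T : μ.Tab) : Prop := μ.RowStrict T ∧ μ.ColStrict T

/-- The permutation `w` with `w ∘ B = T`, e.g. `w^T = wTab T T^μ`, `w_T = wTab T T_μ`. -/
def MPar.wTab (μ : MPar l d) (T B : μ.Tab) : Equiv.Perm (Fin d) := B.symm.trans T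

/-- The node occupied by the entry `r` in `T`. -/
def MPar.nodeOf (μ : MPar l d) (T : μ.Tab) (r : Fin d) : Node l := (T.symm r).1

/-! ## Residues, degrees, codegrees, defect -/

/-- The residue `κ_m + b − a ∈ ℤ/eℤ` of a node `(a,b,m)`. -/
def res (e : ℕ) {l : ℕ} (κ : Fin l → ZMod e) (x : Node l) : ZMod e :=
  κ x.2.2 + (x.2.1 : ZMod e) - (x.1 : ZMod e)

/-- The residue sequence `i(T)` of a tableau. -/
def MPar.resSeq (e : ℕ) (κ : Fin l → ZMod e) (μ : MPar l d) (T : μ.Tab) : Fin d → ZMod e :=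
  fun r => res e κ (μ.nodeOf T r)

/-- A set of nodes is the diagram of a multipartition. -/
def IsDiagram {l : ℕ} (S : Set (Node l)) : Prop :=
  (∀ (a b : ℕ) (m : Fin l), ((a + 1, b, m) : Node l) ∈ S → ((a, b, m) : Node l) ∈ S) ∧
  (∀ (a b : ℕ) (m : Fin l), ((a, b + 1, m) : Node l) ∈ S → ((a, b, m) : Node l) ∈ S)

/-- `B` is an addable node for the diagram `S`. -/
def Addable {l : ℕ} (S : Set (Node l)) (B : Node l) : Prop := B ∉ S ∧ IsDiagram (insert B S)

/-- `A` is a removable node of the diagram `S`. -/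
def Removable {l : ℕ} (S : Set (Node l)) (A : Node l) : Prop := A ∈ S ∧ IsDiagram (S \ {A})

/-- `x` is strictly below `y`. -/
def NodeBelow {l : ℕ} (x y : Node l) : Prop := y.2.2 < x.2.2 ∨ (x.2.2 = y.2.2 ∧ y.1 < x.1)

/-- `d_A(S)`: addable minus removable `i`-nodes strictly below `A`. -/
def dLow (e : ℕ) {l : ℕ} (κ : Fin l → ZMod e) (S : Set (Node l)) (A : Node l) : ℤ :=
  ({B | Addable S B ∧ res e κ B = res e κ A ∧ NodeBelow B A} : Set (Node l)).ncard -
  ({B | Removable S B ∧ res e κ B = res e κ A ∧ NodeBelow B A} : Set (Node l)).ncard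

/-- `d^A(S)`: addable minus removable `i`-nodes strictly above `A`. -/
def dUp (e : ℕ) {l : ℕ} (κ : Fin l → ZMod e) (S : Set (Node l)) (A : Node l) : ℤ :=
  ({B | Addable S B ∧ res e κ B = res e κ A ∧ NodeBelow A B} : Set (Node l)).ncard -
  ({B | Removable S B ∧ res e κ B = res e κ A ∧ NodeBelow A B} : Set (Node l)).ncard

/-- The shape occupied by the entries `< r` of `T`. -/
def MPar.shapeLE (μ : MPar l d) (T : μ.Tab) (r : ℕ) : Set (Node l) :=
  {x | ∃ h : μ.mem x, ((T ⟨x, h⟩ : Fin d) : ℕ) < r}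

/-- The degree of a standard tableau. -/
def MPar.deg (e : ℕ) (κ : Fin l → ZMod e) (μ : MPar l d) (T : μ.Tab) : ℤ :=
  ∑ r : Fin d, dLow e κ (μ.shapeLE T ((r : ℕ) + 1)) (μ.nodeOf T r)

/-- The codegree of a standard tableau. -/
def MPar.codeg (e : ℕ) (κ : Fin l → ZMod e) (μ : MPar l d) (T : μ.Tab) : ℤ :=
  ∑ r : Fin d, dUp e κ (μ.shapeLE T (r : ℕ)) (μ.nodeOf T r)

/-- The Cartan matrix of type `A_∞` (`e = 0`) or `A_{e−1}^{(1)}` (`e > 0`). -/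
def cartanZ (e : ℕ) (i j : ZMod e) : ℤ :=
  if i = j then 2 else (if i = j + 1 then -1 else 0) + (if i + 1 = j then -1 else 0)

/-- The nodes of `μ` as a finset. -/
def MPar.nodesFinset (μ : MPar l d) : Finset (Node l) :=
  (Finset.range d ×ˢ Finset.range d ×ˢ (Finset.univ : Finset (Fin l))).filter
    (fun x => x.2.1 < μ.part x.2.2 x.1)

/-- The defect `(Λ, α) − (α, α)/2` of `α = cont(μ)` relative to `Λ = Σ_m Λ_{κ_m}`. -/
def defectOf (e : ℕ) {l d : ℕ} (κ : Fin l → ZMod e) (μ : MPar l d) : ℤ :=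
  (∑ m : Fin l, ((μ.nodesFinset.filter (fun x => res e κ x = κ m)).card : ℤ)) -
  (∑ x ∈ μ.nodesFinset, ∑ y ∈ μ.nodesFinset, cartanZ e (res e κ x) (res e κ y)) / 2

/-! ## Conjugation -/

/-- Conjugation of nodes: `(a, b, m) ↦ (b, a, l−1−m)`. -/
def nodeConj {l : ℕ} (x : Node l) : Node l := (x.2.1, x.1, x.2.2.rev)

lemma nodeConj_invol {l : ℕ} : Function.Involutive (nodeConj (l := l)) := by
  intro x; simp [nodeConj]

/-- Conjugation of nodes as a bijection. -/
def nodeConjEquiv (l : ℕ) : Equiv.Perm (Node l) :=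
  Function.Involutive.toPerm nodeConj nodeConj_invol

/-- `ν` is the conjugate multipartition `μ'` of `μ`. -/
def IsConjugate (μ ν : MPar l d) : Prop := ∀ x : Node l, μ.mem x ↔ ν.mem (nodeConj x)

/-- The conjugate tableau `T'` of `T`. -/
def conjTab {μ ν : MPar l d} (h : IsConjugate μ ν) (T : μ.Tab) : ν.Tab :=
  (Equiv.subtypeEquiv (nodeConjEquiv l) (fun x => h x)).symm.trans T

/-! ## Garnir nodes, belts, tableaux, and bricks -/

variable (e : ℕ)

/-- A row Garnir node: `(a+1, b, m)` is also a node. -/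
def MPar.IsGarnirNode (μ : MPar l d) (A : Node l) : Prop :=
  μ.mem A ∧ μ.mem (A.1 + 1, A.2.1, A.2.2)

/-- The row `A`-Garnir belt. -/
def MPar.beltR (μ : MPar l d) (A : Node l) : Set (Node l) :=
  {x | x.2.2 = A.2.2 ∧
    ((x.1 = A.1 ∧ A.2.1 ≤ x.2.1 ∧ μ.mem x) ∨ (x.1 = A.1 + 1 ∧ x.2.1 ≤ A.2.1))}

/-- Reading order on the row Garnir belt: bottom-left to top-right. -/
def beltRLt (A x y : Node l) : Prop :=
  (x.1 = A.1 + 1 ∧ y.1 = A.1) ∨ (x.1 = y.1 ∧ x.2.1 < y.2.1)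

/-- `G` is the row `A`-Garnir tableau `G^A`: it agrees with the row-reading tableau `Tr`
outside the belt and is increasing along the belt reading order. -/
def MPar.IsGarnirTab (μ : MPar l d) (Tr : μ.Tab) (A : Node l) (G : μ.Tab) : Prop :=
  (∀ x : μ.NodeIn, x.1 ∉ μ.beltR A → G x = Tr x) ∧
  (∀ x y : μ.NodeIn, x.1 ∈ μ.beltR A → y.1 ∈ μ.beltR A → beltRLt A x.1 y.1 → G x < G y)

/-- A column Garnir node: `(a, b+1, m)` is also a node. -/
def MPar.IsColGarnirNode (μ : MPar l d) (A : Node l) : Prop :=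
  μ.mem A ∧ μ.mem (A.1, A.2.1 + 1, A.2.2)

/-- The column `A`-Garnir belt. -/
def MPar.beltC (μ : MPar l d) (A : Node l) : Set (Node l) :=
  {x | x.2.2 = A.2.2 ∧
    ((x.2.1 = A.2.1 ∧ A.1 ≤ x.1 ∧ μ.mem x) ∨ (x.2.1 = A.2.1 + 1 ∧ x.1 ≤ A.1))}

/-- Reading order on the column Garnir belt: top-right to bottom-left. -/
def beltCLt (A x y : Node l) : Prop :=
  (x.2.1 = A.2.1 + 1 ∧ y.2.1 = A.2.1) ∨ (x.2.1 = y.2.1 ∧ x.1 < y.1)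

/-- `G` is the column `A`-Garnir tableau `G_A`. -/
def MPar.IsColGarnirTab (μ : MPar l d) (Tc : μ.Tab) (A : Node l) (G : μ.Tab) : Prop :=
  (∀ x : μ.NodeIn, x.1 ∉ μ.beltC A → G x = Tc x) ∧
  (∀ x y : μ.NodeIn, x.1 ∈ μ.beltC A → y.1 ∈ μ.beltC A → beltCLt A x.1 y.1 → G x < G y)

/-- A row `A`-brick with leftmost node `(p.1, p.2, m)`: `e` successive nodes of the belt in
one row, the leftmost of residue `res A`. -/
def MPar.IsBrickR (κ : Fin l → ZMod e) (μ : MPar l d) (A : Node l) (p : ℕ × ℕ) : Prop :=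
  0 < e ∧ (∀ t < e, ((p.1, p.2 + t, A.2.2) : Node l) ∈ μ.beltR A) ∧
    res e κ (p.1, p.2, A.2.2) = res e κ A

/-- `k^A`: the number of bricks in the row Garnir belt. -/
def MPar.kAR (κ : Fin l → ZMod e) (μ : MPar l d) (A : Node l) : ℕ :=
  {p : ℕ × ℕ | μ.IsBrickR e κ A p}.ncard

/-- `f^A`: the number of bricks in the upper row `a` of the row Garnir belt. -/
def MPar.fAR (κ : Fin l → ZMod e) (μ : MPar l d) (A : Node l) : ℕ :=
  {p : ℕ × ℕ | μ.IsBrickR e κ A p ∧ p.1 = A.1}.ncard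

/-- The node `x` lies in some row brick. -/
def MPar.inBrickR (κ : Fin l → ZMod e) (μ : MPar l d) (A : Node l) (x : Node l) : Prop :=
  ∃ p : ℕ × ℕ, μ.IsBrickR e κ A p ∧ x.1 = p.1 ∧ x.2.2 = A.2.2 ∧ p.2 ≤ x.2.1 ∧ x.2.1 < p.2 + e

/-- `n^A` (0-indexed): the smallest entry of `G` lying in a brick. -/
def MPar.nAR (κ : Fin l → ZMod e) (μ : MPar l d) (A : Node l) (G : μ.Tab) : ℕ :=
  sInf {q | ∃ x : μ.NodeIn, μ.inBrickR e κ A x.1 ∧ ((G x : Fin d) : ℕ) = q}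

/-- The permutation swapping the `rb`-th and `(rb+1)`-st `e`-blocks of entries starting
at the entry `nn` (everything 0-indexed). -/
def wBrickP (d nn e rb : ℕ) : Equiv.Perm (Fin d) :=
  ((List.range e).map (fun j => swapN d (nn + rb * e + j) (nn + rb * e + e + j))).prod

/-- The row brick permutation group `S^A ≤ S_d`. -/
def MPar.brickGroupR (κ : Fin l → ZMod e) (μ : MPar l d) (A : Node l) (G : μ.Tab) :
    Subgroup (Equiv.Perm (Fin d)) :=
  Subgroup.closure {w | ∃ rb, rb + 1 < μ.kAR e κ A ∧ w = wBrickP d (μ.nAR e κ A G) e rb}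

/-- `Gar^A`: row-strict tableaux obtained from `G = G^A` by brick permutations. -/
def MPar.GarSetR (κ : Fin l → ZMod e) (μ : MPar l d) (A : Node l) (G : μ.Tab) :
    Set (μ.Tab) :=
  {T | μ.RowStrict T ∧ ∃ w ∈ μ.brickGroupR e κ A G, ∀ x, T x = w (G x)}

/-- `TA` is the Bruhat-maximal tableau `T^A` of `Gar^A` (`⊴` via `w_T`, base `Tc = T_μ`). -/
def MPar.IsMaxGarR (κ : Fin l → ZMod e) (μ : MPar l d) (Tc : μ.Tab) (A : Node l)
    (G TA : μ.Tab) : Prop :=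
  TA ∈ μ.GarSetR e κ A G ∧ ∀ T ∈ μ.GarSetR e κ A G, Bruhat d (μ.wTab T Tc) (μ.wTab TA Tc)

/-- A column `A`-brick with top node `(p.1, p.2, m)`. -/
def MPar.IsBrickC (κ : Fin l → ZMod e) (μ : MPar l d) (A : Node l) (p : ℕ × ℕ) : Prop :=
  0 < e ∧ (∀ t < e, ((p.1 + t, p.2, A.2.2) : Node l) ∈ μ.beltC A) ∧
    res e κ (p.1, p.2, A.2.2) = res e κ A

/-- `k_A`: the number of bricks in the column Garnir belt. -/
def MPar.kAC (κ : Fin l → ZMod e) (μ : MPar l d) (A : Node l) : ℕ :=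
  {p : ℕ × ℕ | μ.IsBrickC e κ A p}.ncard

/-- `f_A`: the number of bricks in column `b` of the column Garnir belt. -/
def MPar.fAC (κ : Fin l → ZMod e) (μ : MPar l d) (A : Node l) : ℕ :=
  {p : ℕ × ℕ | μ.IsBrickC e κ A p ∧ p.2 = A.2.1}.ncard

/-- The node `x` lies in some column brick. -/
def MPar.inBrickC (κ : Fin l → ZMod e) (μ : MPar l d) (A : Node l) (x : Node l) : Prop :=
  ∃ p : ℕ × ℕ, μ.IsBrickC e κ A p ∧ x.2.1 = p.2 ∧ x.2.2 = A.2.2 ∧ p.1 ≤ x.1 ∧ x.1 < p.1 + e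

/-- `n_A` (0-indexed): the smallest entry of `G` lying in a column brick. -/
def MPar.nAC (κ : Fin l → ZMod e) (μ : MPar l d) (A : Node l) (G : μ.Tab) : ℕ :=
  sInf {q | ∃ x : μ.NodeIn, μ.inBrickC e κ A x.1 ∧ ((G x : Fin d) : ℕ) = q}

/-- The column brick permutation group `S_A ≤ S_d`. -/
def MPar.brickGroupC (κ : Fin l → ZMod e) (μ : MPar l d) (A : Node l) (G : μ.Tab) :
    Subgroup (Equiv.Perm (Fin d)) :=
  Subgroup.closure {w | ∃ rb, rb + 1 < μ.kAC e κ A ∧ w = wBrickP d (μ.nAC e κ A G) e rb}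

/-- `Gar_A`: column-strict tableaux obtained from `G = G_A` by brick permutations. -/
def MPar.GarSetC (κ : Fin l → ZMod e) (μ : MPar l d) (A : Node l) (G : μ.Tab) :
    Set (μ.Tab) :=
  {T | μ.ColStrict T ∧ ∃ w ∈ μ.brickGroupC e κ A G, ∀ x, T x = w (G x)}

/-- `TA` is the Bruhat-minimal tableau `T_A` of `Gar_A`. -/
def MPar.IsMinGarC (κ : Fin l → ZMod e) (μ : MPar l d) (Tc : μ.Tab) (A : Node l)
    (G TA : μ.Tab) : Prop :=
  TA ∈ μ.GarSetC e κ A G ∧ ∀ T ∈ μ.GarSetC e κ A G, Bruhat d (μ.wTab TA Tc) (μ.wTab T Tc)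

/-! ## The KLR algebra `R_α` by generators and relations -/

/-- Generators of the KLR algebra: idempotents `e(i)`, polynomial generators `y_r`,
and intertwiners `ψ_r`. -/
inductive KLRGen (e d : ℕ) : Type
  | E : (Fin d → ZMod e) → KLRGen e d
  | Y : Fin d → KLRGen e d
  | P : Fin (d - 1) → KLRGen e d

/-- The position `r` as an element of `Fin d`. -/
def finL {d : ℕ} (r : Fin (d - 1)) : Fin d := ⟨r.1, by have := r.2; omega⟩

/-- The position `r + 1` as an element of `Fin d`. -/
def finR {d : ℕ} (r : Fin (d - 1)) : Fin d := ⟨r.1 + 1, by have := r.2; omega⟩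

/-- The place-permutation action of `s_r` on tuples. -/
def swapTup {e d : ℕ} (r : Fin (d - 1)) (i : Fin d → ZMod e) : Fin d → ZMod e :=
  i ∘ (Equiv.swap (finL r) (finR r))

/-- `I^α`: the set of tuples with the same content as the reference tuple `i0`. -/
def tupleOrbit {e d : ℕ} (i0 : Fin d → ZMod e) : Finset (Fin d → ZMod e) :=
  Finset.image (fun w : Equiv.Perm (Fin d) => i0 ∘ w) Finset.univ

section KLRDef

variable (O : Type) [CommRing O] (e d : ℕ)

/-- Image of the generator `e(i)` in the free algebra. -/
def fE (i : Fin d → ZMod e) : FreeAlgebra O (KLRGen e d) := FreeAlgebra.ι O (KLRGen.E i)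

/-- Image of the generator `y_r` in the free algebra. -/
def fY (r : Fin d) : FreeAlgebra O (KLRGen e d) := FreeAlgebra.ι O (KLRGen.Y r)

/-- Image of the generator `ψ_r` in the free algebra. -/
def fP (r : Fin (d - 1)) : FreeAlgebra O (KLRGen e d) := FreeAlgebra.ι O (KLRGen.P r)

/-- Right hand side of the quadratic relation for `ψ_r² e(i)`. -/
def quadElt (i : Fin d → ZMod e) (r : Fin (d - 1)) : FreeAlgebra O (KLRGen e d) :=
  let a := i (finL r); let b := i (finR r)
  if a = b then 0
  else if b = a - 1 ∧ b = a + 1 then (fY O e d (finR r) - fY O e d (finL r)) *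
    (fY O e d (finL r) - fY O e d (finR r)) * fE O e d i
  else if b = a - 1 then (fY O e d (finR r) - fY O e d (finL r)) * fE O e d i
  else if b = a + 1 then (fY O e d (finL r) - fY O e d (finR r)) * fE O e d i
  else fE O e d i

/-- Correction term in the braid relation, at positions `rl < rm < rr`. -/
def braidCorr (i : Fin d → ZMod e) (rl rm rr : Fin d) : FreeAlgebra O (KLRGen e d) :=
  let a := i rl; let b := i rm; let c := i rr
  if c = a ∧ b = a - 1 ∧ b = a + 1 then
    (fY O e d rl + fY O e d rr - 2 * fY O e d rm) * fE O e d i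
  else if c = a ∧ b = a - 1 then fE O e d i
  else if c = a ∧ b = a + 1 then -(fE O e d i)
  else 0

/-- The defining relations of the KLR algebra `R_α`, where `α` is the content of the
reference tuple `i0`. -/
inductive KLRRel (i0 : Fin d → ZMod e) :
    FreeAlgebra O (KLRGen e d) → FreeAlgebra O (KLRGen e d) → Prop
  | idem (i j : Fin d → ZMod e) :
      KLRRel i0 (fE O e d i * fE O e d j) (if i = j then fE O e d i else 0)
  | unit : KLRRel i0 (∑ i ∈ tupleOrbit i0, fE O e d i) 1
  | wrongContent (i : Fin d → ZMod e) (h : i ∉ tupleOrbit i0) : KLRRel i0 (fE O e d i) 0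
  | yE (r : Fin d) (i : Fin d → ZMod e) :
      KLRRel i0 (fY O e d r * fE O e d i) (fE O e d i * fY O e d r)
  | pE (r : Fin (d - 1)) (i : Fin d → ZMod e) :
      KLRRel i0 (fP O e d r * fE O e d i) (fE O e d (swapTup r i) * fP O e d r)
  | yy (r s : Fin d) : KLRRel i0 (fY O e d r * fY O e d s) (fY O e d s * fY O e d r)
  | py (r : Fin (d - 1)) (s : Fin d) (h1 : s ≠ finL r) (h2 : s ≠ finR r) :
      KLRRel i0 (fP O e d r * fY O e d s) (fY O e d s * fP O e d r)
  | pp (r t : Fin (d - 1)) (h : r.1 + 2 ≤ t.1 ∨ t.1 + 2 ≤ r.1) :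
      KLRRel i0 (fP O e d r * fP O e d t) (fP O e d t * fP O e d r)
  | pyE (r : Fin (d - 1)) (i : Fin d → ZMod e) :
      KLRRel i0 (fP O e d r * fY O e d (finR r) * fE O e d i)
        ((fY O e d (finL r) * fP O e d r +
          if i (finL r) = i (finR r) then 1 else 0) * fE O e d i)
  | ypE (r : Fin (d - 1)) (i : Fin d → ZMod e) :
      KLRRel i0 (fY O e d (finR r) * fP O e d r * fE O e d i)
        ((fP O e d r * fY O e d (finL r) +
          if i (finL r) = i (finR r) then 1 else 0) * fE O e d i)
  | quad (r : Fin (d - 1)) (i : Fin d → ZMod e) :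
      KLRRel i0 (fP O e d r * fP O e d r * fE O e d i) (quadElt O e d i r)
  | braid (r : Fin (d - 1)) (h : r.1 + 1 < d - 1) (i : Fin d → ZMod e) :
      KLRRel i0 (fP O e d r * fP O e d ⟨r.1 + 1, h⟩ * fP O e d r * fE O e d i)
        (fP O e d ⟨r.1 + 1, h⟩ * fP O e d r * fP O e d ⟨r.1 + 1, h⟩ * fE O e d i +
          braidCorr O e d i (finL r) (finR r) ⟨r.1 + 2, by omega⟩)

/-- The KLR algebra `R_α` over `O`, where `α` is the content of the tuple `i0`. -/
abbrev KLR (i0 : Fin d → ZMod e) : Type := RingQuot (KLRRel O e d i0)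

end KLRDef

section KLRElts

variable (O : Type) [CommRing O] {e d : ℕ} (i0 : Fin d → ZMod e)

/-- The idempotent generator `e(i)` of `R_α`. -/
def eK (i : Fin d → ZMod e) : KLR O e d i0 :=
  RingQuot.mkAlgHom O (KLRRel O e d i0) (fE O e d i)

/-- The generator `y_r` of `R_α`. -/
def yK (r : Fin d) : KLR O e d i0 :=
  RingQuot.mkAlgHom O (KLRRel O e d i0) (fY O e d r)

/-- The generator `ψ_r` of `R_α`. -/
def pK (r : Fin (d - 1)) : KLR O e d i0 :=
  RingQuot.mkAlgHom O (KLRRel O e d i0) (fP O e d r)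

/-- `y_s` for a natural number index (0-indexed), or `0` out of range. -/
def yN (s : ℕ) : KLR O e d i0 := if h : s < d then yK O i0 ⟨s, h⟩ else 0

/-- `ψ_t` for a natural number index (0-indexed), or `0` out of range. -/
def pN (t : ℕ) : KLR O e d i0 := if h : t < d - 1 then pK O i0 ⟨t, h⟩ else 0

/-- `ψ_{r_1} ⋯ ψ_{r_m}` for a word `[r_1, …, r_m]`. -/
def psiWord (lw : List ℕ) : KLR O e d i0 := (lw.map (pN O i0)).prod

/-- `ψ_w` relative to a choice `rd` of preferred reduced decompositions. -/
def psiPerm (rd : Equiv.Perm (Fin d) → List ℕ) (w : Equiv.Perm (Fin d)) : KLR O e d i0 :=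
  psiWord O i0 (rd w)

end KLRElts

/-! ## The grading on the KLR algebra -/

/-- One step in computing the degree of a word in the generators, scanning right to left:
the state is (accumulated degree, current tuple). -/
def gstep {e d : ℕ} (g : KLRGen e d) (p : ℤ × (Fin d → ZMod e)) : ℤ × (Fin d → ZMod e) :=
  match g with
  | .E i => (p.1, i)
  | .Y _ => (p.1 + 2, p.2)
  | .P r => (p.1 - cartanZ e (p.2 (finL r)) (p.2 (finR r)), swapTup r p.2)

/-- The degree of the word `lg` followed by the idempotent `e(j)`. -/
def wordDeg {e d : ℕ} (lg : List (KLRGen e d)) (j : Fin d → ZMod e) : ℤ :=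
  (lg.foldr gstep (0, j)).1

/-- The degree-`n` homogeneous component of `R_α`, as an `O`-submodule. -/
def algGrade (O : Type) [CommRing O] {e d : ℕ} (i0 : Fin d → ZMod e) (n : ℤ) :
    Submodule O (KLR O e d i0) :=
  Submodule.span O {x | ∃ (lg : List (KLRGen e d)) (j : Fin d → ZMod e),
    wordDeg lg j = n ∧
    x = RingQuot.mkAlgHom O (KLRRel O e d i0) ((lg.map (FreeAlgebra.ι O)).prod * fE O e d j)}

/-! ## Cyclic modules presented by a set of left-ideal generators -/

section Modules

variable (O : Type) [CommRing O] {e d : ℕ} (i0 : Fin d → ZMod e)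

/-- The cyclic `R_α`-module `R_α / (left ideal generated by S)`. -/
abbrev QuotBy (S : Set (KLR O e d i0)) : Type :=
  KLR O e d i0 ⧸ Submodule.span (KLR O e d i0) S

/-- The canonical cyclic generator (image of `1`) of `QuotBy S`. -/
def genQ (S : Set (KLR O e d i0)) : QuotBy O i0 S :=
  Submodule.Quotient.mk 1

/-- Degree-`n` part of the cyclic graded module `QuotBy S` whose generator
is placed in degree `base`. -/
def gradeQ (S : Set (KLR O e d i0)) (base n : ℤ) : Submodule O (QuotBy O i0 S) :=
  Submodule.span O {v | ∃ x ∈ algGrade O i0 (n - base), v = x • genQ O i0 S}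

/-- Generators of the annihilator ideal of a "permutation module" with reference
idempotent `e(iref)` and parabolic crossings `psis`: this encodes the relations
`e(j) m = δ_{j,iref} m`, `y_r m = 0`, and `ψ_t m = 0` for `s_t` in the parabolic. -/
def permGens (iref : Fin d → ZMod e) (psis : Set ℕ) : Set (KLR O e d i0) :=
  {x | ∃ j : Fin d → ZMod e, x = eK O i0 j - (if j = iref then 1 else 0)} ∪
  {x | ∃ r : Fin d, x = yK O i0 r} ∪
  {x | ∃ t ∈ psis, x = pN O i0 t}

end Modules

/-! ## Row/column permutation modules and Garnir elements -/

/-- Crossings `t` such that the entries `t, t+1` of `Tr` lie in the same row of the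
same component; for `Tr = T^μ` these generate the row parabolic. -/
def MPar.rowPsiSet {l d : ℕ} (μ : MPar l d) (Tr : μ.Tab) : Set ℕ :=
  {t | ∃ h : t + 1 < d, (μ.nodeOf Tr ⟨t, Nat.lt_of_succ_lt h⟩).1 = (μ.nodeOf Tr ⟨t + 1, h⟩).1 ∧
      (μ.nodeOf Tr ⟨t, Nat.lt_of_succ_lt h⟩).2.2 = (μ.nodeOf Tr ⟨t + 1, h⟩).2.2}

/-- Crossings `t` such that the entries `t, t+1` of `Tc` lie in the same column of the
same component; for `Tc = T_μ` these generate the column parabolic. -/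
def MPar.colPsiSet {l d : ℕ} (μ : MPar l d) (Tc : μ.Tab) : Set ℕ :=
  {t | ∃ h : t + 1 < d,
      (μ.nodeOf Tc ⟨t, Nat.lt_of_succ_lt h⟩).2.1 = (μ.nodeOf Tc ⟨t + 1, h⟩).2.1 ∧
      (μ.nodeOf Tc ⟨t, Nat.lt_of_succ_lt h⟩).2.2 = (μ.nodeOf Tc ⟨t + 1, h⟩).2.2}

section Garnir

variable (O : Type) [CommRing O] {e l d : ℕ} (κ : Fin l → ZMod e) {μ : MPar l d}
  (i0 : Fin d → ZMod e) (rdAll : ∀ q : ℕ, Equiv.Perm (Fin q) → List ℕ)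

/-- The row brick intertwiner `σ^A_r = ψ_{w^A_r} e(i^A)` (0-indexed `rb`). -/
def sigmaR (A : Node l) (G : μ.Tab) (rb : ℕ) : KLR O e d i0 :=
  psiWord O i0 (rdAll d (wBrickP d (μ.nAR e κ A G) e rb)) * eK O i0 (μ.resSeq e κ G)

/-- The row brick intertwiner `τ^A_r = (σ^A_r + 1) e(i^A)`. -/
def tauR (A : Node l) (G : μ.Tab) (rb : ℕ) : KLR O e d i0 :=
  sigmaR O κ i0 rdAll A G rb + eK O i0 (μ.resSeq e κ G)

/-- `τ^A_u` for `u ∈ S_k`, via the preferred reduced decomposition of `u`. -/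
def tauRU (A : Node l) (G : μ.Tab) (kk : ℕ) (u : Equiv.Perm (Fin kk)) : KLR O e d i0 :=
  ((rdAll kk u).map (fun rb => tauR O κ i0 rdAll A G rb)).prod

/-- The homogeneous row Garnir element `g^A = Σ_{u ∈ D^A} τ^A_u ψ^{T^A}`. -/
def garnirR (Tr : μ.Tab) (A : Node l) (G TA : μ.Tab) : KLR O e d i0 :=
  ∑ u ∈ DfkFinset (μ.kAR e κ A) (μ.fAR e κ A),
    tauRU O κ i0 rdAll A G (μ.kAR e κ A) u * psiWord O i0 (rdAll d (μ.wTab TA Tr))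

/-- The column brick intertwiner `σ^r_A = (−1)^e ψ_{w^r_A} e(i_A)`. -/
def sigmaC (A : Node l) (G : μ.Tab) (rb : ℕ) : KLR O e d i0 :=
  ((-1 : KLR O e d i0) ^ e) *
    psiWord O i0 (rdAll d (wBrickP d (μ.nAC e κ A G) e rb)) * eK O i0 (μ.resSeq e κ G)

/-- The column brick intertwiner `τ^r_A = (σ^r_A + 1) e(i_A)`. -/
def tauC (A : Node l) (G : μ.Tab) (rb : ℕ) : KLR O e d i0 :=
  sigmaC O κ i0 rdAll A G rb + eK O i0 (μ.resSeq e κ G)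

/-- `τ^u_A` for `u ∈ S_k`. -/
def tauCU (A : Node l) (G : μ.Tab) (kk : ℕ) (u : Equiv.Perm (Fin kk)) : KLR O e d i0 :=
  ((rdAll kk u).map (fun rb => tauC O κ i0 rdAll A G rb)).prod

/-- The homogeneous column Garnir element `g_A = Σ_{u ∈ D_A} τ^u_A ψ_{T_A}`. -/
def garnirC (Tc : μ.Tab) (A : Node l) (G TA : μ.Tab) : KLR O e d i0 :=
  ∑ u ∈ DfkFinset (μ.kAC e κ A) (μ.fAC e κ A),
    tauCU O κ i0 rdAll A G (μ.kAC e κ A) u * psiWord O i0 (rdAll d (μ.wTab TA Tc))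

/-- Generators of the defining left ideal of the universal graded row Specht
module `S^μ` (relations (i)–(iv) of the universal Specht presentation). -/
def spechtRowGens (Tr Tc : μ.Tab) : Set (KLR O e d i0) :=
  permGens O i0 (μ.resSeq e κ Tr) (μ.rowPsiSet Tr) ∪
  {x | ∃ (A : Node l) (G TA : μ.Tab), μ.IsGarnirNode A ∧ μ.IsGarnirTab Tr A G ∧
      μ.IsMaxGarR e κ Tc A G TA ∧ x = garnirR O κ i0 rdAll Tr A G TA}

/-- Generators of the defining left ideal of the universal graded column Specht
module `S_μ`. -/
def spechtColGens (Tc : μ.Tab) : Set (KLR O e d i0) :=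
  permGens O i0 (μ.resSeq e κ Tc) (μ.colPsiSet Tc) ∪
  {x | ∃ (A : Node l) (G TA : μ.Tab), μ.IsColGarnirNode A ∧ μ.IsColGarnirTab Tc A G ∧
      μ.IsMinGarC e κ Tc A G TA ∧ x = garnirC O κ i0 rdAll Tc A G TA}

end Garnir

/-! ## Block intertwiners for `R_{kδ}` -/

/-- The tuple `s(i, ke) = (i, i+1, …, i+ke−1)`, of content `kδ`. -/
def segTup (e k : ℕ) (i : ZMod e) : Fin (k * e) → ZMod e := fun t => i + ((t : ℕ) : ZMod e)

/-- The multiples `e·(λ_1 + ⋯ + λ_j)` of partial sums of a composition, scaled by `e`. -/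
def cutSet (e : ℕ) {n : ℕ} (lam : Fin n → ℕ) : Set ℕ :=
  {t | ∃ j : Fin n, t = e * ∑ j' ∈ Finset.univ.filter (fun j' => j' ≤ j), lam j'}

/-- Crossings `t` (0-indexed) with `s_t` in the parabolic `S_{eλ_1} × ⋯ × S_{eλ_n}`. -/
def blockPsiSet (e k : ℕ) {n : ℕ} (lam : Fin n → ℕ) : Set ℕ :=
  {t | t + 1 < k * e ∧ (t + 1) ∉ cutSet e lam}

section Block

variable (O : Type) [CommRing O] (e k : ℕ) (i : ZMod e) {n : ℕ} (lam : Fin n → ℕ)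
  (rdAll : ∀ q : ℕ, Equiv.Perm (Fin q) → List ℕ)

/-- The permutation module `M(i,λ)` over `R_{kδ}`. -/
abbrev MPerm : Type :=
  QuotBy O (segTup e k i) (permGens O (segTup e k i) (segTup e k i) (blockPsiSet e k lam))

/-- The cyclic generator `m(i,λ)` of `M(i,λ)`. -/
abbrev mPerm : MPerm O e k i lam :=
  genQ O (segTup e k i) (permGens O (segTup e k i) (segTup e k i) (blockPsiSet e k lam))

/-- The block intertwiner `σ_r = ψ_{w_r} e(i,λ)` (0-indexed `rb`). -/
def sigmaB (rb : ℕ) : KLR O e (k * e) (segTup e k i) :=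
  psiWord O (segTup e k i) (rdAll (k * e) (wBrickP (k * e) 0 e rb)) * eK O (segTup e k i) (segTup e k i)

/-- The block intertwiner `τ_r = σ_r + e(i,λ)`. -/
def tauB (rb : ℕ) : KLR O e (k * e) (segTup e k i) :=
  sigmaB O e k i rdAll rb + eK O (segTup e k i) (segTup e k i)

/-- `τ_u` for `u ∈ S_k`, via the preferred reduced decomposition of `u`. -/
def tauBU (u : Equiv.Perm (Fin k)) : KLR O e (k * e) (segTup e k i) :=
  ((rdAll k u).map (tauB O e k i rdAll)).prod

/-- The block permutation subspace `T(i,λ) ⊆ M(i,λ)`. -/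
def TBlock : Submodule O (MPerm O e k i lam) :=
  Submodule.span O {v | ∃ rs : List ℕ, (∀ rb ∈ rs, rb + 1 < k) ∧
    v = ((rs.map (sigmaB O e k i rdAll)).prod) • mPerm O e k i lam}

/-- The parabolic subgroup `S_λ = S_{λ_1} × ⋯ × S_{λ_n}` of `S_k`. -/
def SlamSub : Subgroup (Equiv.Perm (Fin k)) :=
  Subgroup.closure {w | ∃ r, r + 1 < k ∧ (r + 1) ∉ cutSet 1 lam ∧ w = stp k r}

/-- The minimal length left coset representatives `D_λ` of `S_λ` in `S_k`. -/
def DlamSet : Set (Equiv.Perm (Fin k)) := {u | IsMinCosetRep k (SlamSub k lam) u}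

end Block

/-! ## STATEMENT 12: every non-standard row-strict tableau factors through a Garnir
tableau with additive lengths. -/

/-- The set of inversions of a permutation. -/
def invSet {d : ℕ} (w : Equiv.Perm (Fin d)) : Finset (Fin d × Fin d) :=
  Finset.univ.filter (fun p => p.1 < p.2 ∧ w p.2 < w p.1)

lemma mem_invSet {d : ℕ} (w : Equiv.Perm (Fin d)) (i j : Fin d) :
    (i, j) ∈ invSet w ↔ i < j ∧ w j < w i := by
  simp [invSet]

lemma invSet_card_mul {d : ℕ} (w v : Equiv.Perm (Fin d))
    (h : ∀ i j, i < j → v j < v i → w (v j) < w (v i)) :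
    (invSet (w * v)).card = (invSet v).card + (invSet w).card := by
  classical
  have hsub : invSet v ⊆ invSet (w * v) := by
    rintro ⟨i, j⟩ hij
    rw [mem_invSet] at hij ⊢
    exact ⟨hij.1, h i j hij.1 hij.2⟩
  have hb : (invSet (w * v) \ invSet v).card = (invSet w).card := by
    apply Finset.card_bij (fun p _ => (v p.1, v p.2))
    · rintro ⟨i, j⟩ hij
      rw [Finset.mem_sdiff, mem_invSet, mem_invSet] at hij
      rw [mem_invSet]
      obtain ⟨⟨h1, h2⟩, h3⟩ := hij
      refine ⟨?_, h2⟩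
      have hne : v i ≠ v j := fun e => h1.ne (v.injective e)
      rcases lt_or_gt_of_ne hne with h4 | h4
      · exact h4
      · exact absurd ⟨h1, h4⟩ h3
    · rintro ⟨i, j⟩ _ ⟨itwo, jtwo⟩ _ he
      simpa using he
    · rintro ⟨p, q⟩ hpq
      rw [mem_invSet] at hpq
      obtain ⟨i, rfl⟩ := v.surjective p
      obtain ⟨j, rfl⟩ := v.surjective q
      refine ⟨(i, j), ?_, rfl⟩
      rw [Finset.mem_sdiff, mem_invSet, mem_invSet]
      have hij : i < j := by
        by_contra hc
        have hne : i ≠ j := by rintro rfl; exact lt_irrefl _ hpq.1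
        have hji : j < i := lt_of_le_of_ne (not_lt.mp hc) hne.symm
        exact lt_asymm hpq.2 (h j i hji hpq.1)
      exact ⟨⟨hij, hpq.2⟩, fun hc => lt_asymm hpq.1 hc.2⟩
  have := Finset.card_sdiff_add_card_eq_card hsub
  omega

lemma stp_apply {d r : ℕ} (h : r + 1 < d) (i : Fin d) :
    ((stp d r i : Fin d) : ℕ) =
      if (i : ℕ) = r then r + 1 else if (i : ℕ) = r + 1 then r else i := by
  simp only [stp, h, dif_pos, Equiv.swap_apply_def, Fin.ext_iff]
  split_ifs <;> simp

lemma stp_mul_self (d r : ℕ) : stp d r * stp d r = 1 := by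
  unfold stp
  split_ifs <;> simp

lemma invSet_stp {d r : ℕ} (h : r + 1 < d) :
    invSet (stp d r) = {(⟨r, Nat.lt_of_succ_lt h⟩, ⟨r + 1, h⟩)} := by
  ext ⟨i, j⟩
  rw [mem_invSet, Finset.mem_singleton, Prod.mk.injEq, Fin.lt_def, Fin.lt_def,
    stp_apply h, stp_apply h, Fin.ext_iff, Fin.ext_iff]
  simp only
  split_ifs <;> omega

lemma inv_desc {d r : ℕ} (h : r + 1 < d) (w : Equiv.Perm (Fin d))
    (hw : w ⟨r + 1, h⟩ < w ⟨r, Nat.lt_of_succ_lt h⟩) :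
    (invSet w).card = (invSet (w * stp d r)).card + 1 := by
  have h1 := invSet_card_mul (w * stp d r) (stp d r) (by
    intro i j hij hji
    have : (i, j) ∈ invSet (stp d r) := (mem_invSet _ _ _).2 ⟨hij, hji⟩
    rw [invSet_stp h, Finset.mem_singleton, Prod.mk.injEq] at this
    obtain ⟨rfl, rfl⟩ := this
    rw [← Equiv.Perm.mul_apply, ← Equiv.Perm.mul_apply, mul_assoc, stp_mul_self, mul_one]
    exact hw)
  rw [mul_assoc, stp_mul_self, mul_one, invSet_stp h, Finset.card_singleton] at h1
  omega

lemma stp_left {d r : ℕ} (h : r + 1 < d) :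
    stp d r ⟨r, Nat.lt_of_succ_lt h⟩ = ⟨r + 1, h⟩ := by
  simp [stp, h]

lemma stp_right {d r : ℕ} (h : r + 1 < d) :
    stp d r ⟨r + 1, h⟩ = ⟨r, Nat.lt_of_succ_lt h⟩ := by
  simp [stp, h]

lemma inv_mul_stp_le {d r : ℕ} (h : r + 1 < d) (w : Equiv.Perm (Fin d)) :
    (invSet (w * stp d r)).card ≤ (invSet w).card + 1 := by
  have hne : w ⟨r + 1, h⟩ ≠ w ⟨r, Nat.lt_of_succ_lt h⟩ := by
    intro e
    have := w.injective e
    simp [Fin.ext_iff] at this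
  rcases lt_or_gt_of_ne hne with h1 | h1
  · have := inv_desc h w h1
    omega
  · have := inv_desc h (w * stp d r) (by
      rw [Equiv.Perm.mul_apply, Equiv.Perm.mul_apply, stp_left h, stp_right h]; exact h1)
    rw [mul_assoc, stp_mul_self, mul_one] at this
    omega

lemma invSet_one_card (d : ℕ) : (invSet (1 : Equiv.Perm (Fin d))).card = 0 := by
  rw [Finset.card_eq_zero, Finset.eq_empty_iff_forall_notMem]
  rintro ⟨i, j⟩ hij
  rw [mem_invSet] at hij
  exact lt_asymm hij.1 hij.2

lemma inv_wordProd_le (d : ℕ) (lw : List ℕ) (h : IsWord d lw) :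
    (invSet (wordProd d lw)).card ≤ lw.length := by
  induction lw using List.reverseRecOn with
  | nil => exact (invSet_one_card d).le
  | append_singleton xs r ih =>
    have h1 := ih (fun t ht => h t (by simp [ht]))
    have h2 := inv_mul_stp_le (h r (by simp)) (wordProd d xs)
    have h3 : wordProd d (xs ++ [r]) = wordProd d xs * stp d r := by simp [wordProd]
    rw [h3, List.length_append, List.length_singleton]
    omega

lemma eq_one_of_no_desc {d : ℕ} (w : Equiv.Perm (Fin d))
    (h : ∀ r (hr : r + 1 < d), w ⟨r, Nat.lt_of_succ_lt hr⟩ < w ⟨r + 1, hr⟩) : w = 1 := by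
  have hm : StrictMono w := by
    cases d with
    | zero => exact fun i => i.elim0
    | succ n =>
      rw [Fin.strictMono_iff_lt_succ]
      intro i
      exact h i (by omega)
  have hu : (hm.orderIsoOfSurjective w w.surjective) = OrderIso.refl (Fin d) :=
    Subsingleton.elim _ _
  ext i
  have := congrArg (fun f => f i) hu
  simpa using congrArg Fin.val this

lemma exists_word {d : ℕ} (n : ℕ) : ∀ w : Equiv.Perm (Fin d), (invSet w).card = n →
    ∃ lw, IsWord d lw ∧ lw.length = n ∧ wordProd d lw = w := by
  induction n with
  | zero =>
    intro w hw
    refine ⟨[], by simp [IsWord], rfl, ?_⟩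
    rw [eq_one_of_no_desc w]
    · simp [wordProd]
    · intro r hr
      by_contra hc
      have hne : w ⟨r, Nat.lt_of_succ_lt hr⟩ ≠ w ⟨r + 1, hr⟩ := by
        intro e
        have := w.injective e
        simp [Fin.ext_iff] at this
      have := inv_desc hr w (lt_of_le_of_ne (not_lt.mp hc) hne.symm)
      omega
  | succ n ih =>
    intro w hw
    by_cases hd : ∀ r (hr : r + 1 < d), w ⟨r, Nat.lt_of_succ_lt hr⟩ < w ⟨r + 1, hr⟩
    · rw [eq_one_of_no_desc w hd, invSet_one_card] at hw
      omega
    · push Not at hd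
      obtain ⟨r, hr, hle⟩ := hd
      have hne : w ⟨r, Nat.lt_of_succ_lt hr⟩ ≠ w ⟨r + 1, hr⟩ := by
        intro e
        have := w.injective e
        simp [Fin.ext_iff] at this
      have h1 := inv_desc hr w (lt_of_le_of_ne hle hne.symm)
      obtain ⟨lw, hl1, hl2, hl3⟩ := ih (w * stp d r) (by omega)
      refine ⟨lw ++ [r], ?_, by simp [hl2], ?_⟩
      · intro t ht
        rw [List.mem_append, List.mem_singleton] at ht
        rcases ht with ht | rfl
        · exact hl1 t ht
        · exact hr
      · have h3 : wordProd d (lw ++ [r]) = wordProd d lw * stp d r := by simp [wordProd]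
        rw [h3, hl3, mul_assoc, stp_mul_self, mul_one]

lemma len_eq_inv {d : ℕ} (w : Equiv.Perm (Fin d)) : len d w = (invSet w).card := by
  apply le_antisymm
  · exact Nat.sInf_le (exists_word _ w rfl)
  · refine le_csInf ⟨_, exists_word _ w rfl⟩ ?_
    rintro n ⟨lw, h1, rfl, rfl⟩
    exact inv_wordProd_le d lw h1

/-- The rotation exchanging the consecutive intervals `[u, s)` and `[s, v]`. -/
def rotPerm {d : ℕ} (u s v : Fin d) (h1 : u < s) (h2 : s ≤ v) : Equiv.Perm (Fin d) where
  toFun i := ⟨if (u : ℕ) ≤ i ∧ (i : ℕ) < s then (i : ℕ) + ((v : ℕ) + 1 - (s : ℕ))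
      else if (s : ℕ) ≤ i ∧ (i : ℕ) ≤ v then (i : ℕ) - ((s : ℕ) - (u : ℕ)) else (i : ℕ), by
    have := i.2; have := v.2; rw [Fin.lt_def] at h1; rw [Fin.le_def] at h2
    split_ifs <;> omega⟩
  invFun i := ⟨if (u : ℕ) ≤ i ∧ (i : ℕ) < u + (v + 1 - s) then i + (s - u)
      else if (u : ℕ) + (v + 1 - s) ≤ i ∧ (i : ℕ) ≤ v then i - (v + 1 - s) else i, by
    have := i.2; have := v.2; rw [Fin.lt_def] at h1; rw [Fin.le_def] at h2
    split_ifs <;> omega⟩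
  left_inv i := by
    rw [Fin.lt_def] at h1; rw [Fin.le_def] at h2
    apply Fin.ext
    simp only
    split_ifs <;> omega
  right_inv i := by
    rw [Fin.lt_def] at h1; rw [Fin.le_def] at h2
    apply Fin.ext
    simp only
    split_ifs <;> omega

lemma rotPerm_val {d : ℕ} (u s v : Fin d) (h1 : u < s) (h2 : s ≤ v) (i : Fin d) :
    ((rotPerm u s v h1 h2 i : Fin d) : ℕ) =
      if (u : ℕ) ≤ i ∧ (i : ℕ) < s then (i : ℕ) + ((v : ℕ) + 1 - (s : ℕ))
      else if (s : ℕ) ≤ i ∧ (i : ℕ) ≤ v then (i : ℕ) - ((s : ℕ) - (u : ℕ)) else (i : ℕ) := rfl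

lemma rowLt_trichotomy {l : ℕ} (x y : Node l) : rowLt x y ∨ x = y ∨ rowLt y x := by
  obtain ⟨a, b, m⟩ := x
  obtain ⟨atwo, btwo, mtwo⟩ := y
  simp only [rowLt, Prod.mk.injEq, Fin.lt_def, Fin.ext_iff]
  omega

lemma rowReading_iff {l d : ℕ} {μ : MPar l d} {Tr : μ.Tab} (hTr : μ.IsRowReading Tr)
    (x y : μ.NodeIn) : Tr x < Tr y ↔ rowLt x.1 y.1 := by
  refine ⟨fun h => ?_, hTr x y⟩
  rcases rowLt_trichotomy x.1 y.1 with h1 | h1 | h1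
  · exact h1
  · rw [Subtype.ext h1] at h
    exact absurd h (lt_irrefl _)
  · exact absurd h (lt_asymm (hTr y x h1))

lemma rowReading_le_iff {l d : ℕ} {μ : MPar l d} {Tr : μ.Tab} (hTr : μ.IsRowReading Tr)
    (x y : μ.NodeIn) : Tr x ≤ Tr y ↔ ¬ rowLt y.1 x.1 := by
  rw [← rowReading_iff hTr, not_lt]

lemma mem_up {l d : ℕ} (μ : MPar l d) {a atwo b : ℕ} {m : Fin l} (h : a ≤ atwo)
    (hm : μ.mem (atwo, b, m)) : μ.mem (a, b, m) :=
  lt_of_lt_of_le hm (μ.anti m h)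

lemma exists_adjacent {l d : ℕ} (μ : MPar l d) (T : μ.Tab) (h : ¬ μ.ColStrict T) :
    ∃ (a b : ℕ) (m : Fin l) (h1 : μ.mem (a, b, m)) (h2 : μ.mem (a + 1, b, m)),
      T ⟨_, h2⟩ < T ⟨_, h1⟩ := by
  by_contra hc
  push Not at hc
  apply h
  have key : ∀ (n a b : ℕ) (m : Fin l) (h1 : μ.mem (a, b, m)) (h2 : μ.mem (a + n + 1, b, m)),
      T ⟨_, h1⟩ < T ⟨_, h2⟩ := by
    have step : ∀ (a b : ℕ) (m : Fin l) (h1 : μ.mem (a, b, m)) (h2 : μ.mem (a + 1, b, m)),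
        T ⟨_, h1⟩ < T ⟨_, h2⟩ := by
      intro a b m h1 h2
      refine lt_of_le_of_ne (hc a b m h1 h2) (fun e => ?_)
      have := T.injective e
      simp at this
    intro n
    induction n with
    | zero => exact step
    | succ n ih =>
      intro a b m h1 h2
      have h3 : μ.mem (a + n + 1, b, m) := mem_up μ (by omega) h2
      exact lt_trans (ih a b m h1 h3) (step (a + n + 1) b m h3 h2)
  rintro ⟨⟨a, b, m⟩, hx⟩ ⟨⟨atwo, btwo, mtwo⟩, hy⟩ hb hm ha
  simp only at hb hm ha
  subst hb hm
  obtain ⟨n, rfl⟩ := Nat.exists_eq_add_of_lt ha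
  exact key n a b m hx hy

theorem rowStrict_factor_through_garnir {l d : ℕ} (μ : MPar l d)
    (Tr : μ.Tab) (hTr : μ.IsRowReading Tr)
    (T : μ.Tab) (hrs : μ.RowStrict T) (hns : ¬ μ.IsStandard T) :
    ∃ A : Node l, μ.IsGarnirNode A ∧ ∃ G : μ.Tab, μ.IsGarnirTab Tr A G ∧
      ∃ w : Equiv.Perm (Fin d), (∀ x, T x = w (G x)) ∧
        len d (μ.wTab T Tr) = len d (μ.wTab G Tr) + len d w := by
  obtain ⟨a, b, m, hA, hB, hlt⟩ := exists_adjacent μ T (fun hc => hns ⟨hrs, hc⟩)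
  have hS : μ.mem (a + 1, 0, m) := lt_of_le_of_lt (Nat.zero_le _) hB
  have hus : Tr ⟨_, hA⟩ < Tr ⟨_, hS⟩ := by
    rw [rowReading_iff hTr]
    simp [rowLt]
  have hsv : Tr ⟨_, hS⟩ ≤ Tr ⟨_, hB⟩ := by
    rw [rowReading_le_iff hTr]
    simp [rowLt]
  -- the two halves of the belt as intervals
  have htop : ∀ x : μ.NodeIn, (Tr ⟨_, hA⟩ ≤ Tr x ∧ Tr x < Tr ⟨_, hS⟩) ↔
      (x.1.2.2 = m ∧ x.1.1 = a ∧ b ≤ x.1.2.1) := by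
    rintro ⟨⟨atwo, btwo, mtwo⟩, hx⟩
    rw [rowReading_le_iff hTr, rowReading_iff hTr]
    simp only [rowLt, Fin.lt_def, Fin.ext_iff]
    omega
  have hbot : ∀ x : μ.NodeIn, (Tr ⟨_, hS⟩ ≤ Tr x ∧ Tr x ≤ Tr ⟨_, hB⟩) ↔
      (x.1.2.2 = m ∧ x.1.1 = a + 1 ∧ x.1.2.1 ≤ b) := by
    rintro ⟨⟨atwo, btwo, mtwo⟩, hx⟩
    rw [rowReading_le_iff hTr, rowReading_le_iff hTr]
    simp only [rowLt, Fin.lt_def, Fin.ext_iff]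
    omega
  have hbelt : ∀ x : μ.NodeIn, x.1 ∈ μ.beltR (a, b, m) ↔
      ((x.1.2.2 = m ∧ x.1.1 = a ∧ b ≤ x.1.2.1) ∨
        (x.1.2.2 = m ∧ x.1.1 = a + 1 ∧ x.1.2.1 ≤ b)) := by
    intro x
    have := x.2
    simp only [MPar.beltR, Set.mem_ofPred_eq]
    tauto
  set u := Tr ⟨_, hA⟩ with hu
  set s := Tr ⟨_, hS⟩ with hs
  set v := Tr ⟨_, hB⟩ with hv
  let g := rotPerm u s v hus hsv
  have hg : ∀ i, ((g i : Fin d) : ℕ) = if (u : ℕ) ≤ i ∧ (i : ℕ) < s then (i : ℕ) + ((v : ℕ) + 1 - (s : ℕ))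
      else if (s : ℕ) ≤ i ∧ (i : ℕ) ≤ v then (i : ℕ) - ((s : ℕ) - (u : ℕ)) else (i : ℕ) := rotPerm_val u s v hus hsv
  refine ⟨(a, b, m), ⟨hA, hB⟩, Tr.trans g, ⟨?_, ?_⟩, (Tr.trans g).symm.trans T, ?_, ?_⟩
  · intro x hx
    rw [hbelt, ← htop, ← hbot] at hx
    push Not at hx
    simp only [Fin.le_def, Fin.lt_def] at hx
    apply Fin.ext
    rw [Equiv.trans_apply, hg]
    split_ifs <;> omega
  · intro x y hx hy hxy
    rw [hbelt] at hx hy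
    have hxycase : (x.1.1 = a + 1 ∧ y.1.1 = a) ∨ (x.1.1 = y.1.1 ∧ x.1.2.1 < y.1.2.1) := hxy
    have hmono : x.1.2.2 = y.1.2.2 → x.1.1 = y.1.1 → x.1.2.1 < y.1.2.1 →
        ((Tr x : Fin d) : ℕ) < Tr y := by
      intro e1 e2 e3
      exact hTr x y (Or.inr ⟨e1, Or.inr ⟨e2, e3⟩⟩)
    have tx := htop x
    have ty := htop y
    have bx := hbot x
    have bY := hbot y
    simp only [Fin.le_def, Fin.lt_def] at tx ty bx bY hus hsv
    rw [Fin.lt_def, Equiv.trans_apply, Equiv.trans_apply, hg, hg]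
    rcases hx with hx | hx <;> rcases hy with hy | hy
    · have h3 := hmono (hx.1.trans hy.1.symm) (by omega) (by omega)
      have := tx.2 hx
      have := ty.2 hy
      split_ifs <;> omega
    · omega
    · have := bx.2 hx
      have := ty.2 hy
      split_ifs <;> omega
    · have h3 := hmono (hx.1.trans hy.1.symm) (by omega) (by omega)
      have := bx.2 hx
      have := bY.2 hy
      split_ifs <;> omega
  · intro x
    simp
  · have e1 : μ.wTab (Tr.trans g) Tr = g := by
      ext i
      simp [MPar.wTab]
    have e2 : μ.wTab T Tr = ((Tr.trans g).symm.trans T) * g := by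
      ext i
      simp [MPar.wTab]
    have e3 : ∀ i, ((Tr.trans g).symm.trans T) (g i) = T (Tr.symm i) := by
      intro i
      simp
    rw [e1, e2, len_eq_inv, len_eq_inv, len_eq_inv]
    apply invSet_card_mul
    intro i j hij hji
    rw [e3, e3]
    obtain ⟨x, rfl⟩ := Tr.surjective i
    obtain ⟨y, rfl⟩ := Tr.surjective j
    rw [Equiv.symm_apply_apply, Equiv.symm_apply_apply]
    have hxy : (u ≤ Tr x ∧ Tr x < s) ∧ (s ≤ Tr y ∧ Tr y ≤ v) := by
      rw [Fin.lt_def, hg, hg] at hji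
      simp only [Fin.le_def, Fin.lt_def] at hij hus hsv ⊢
      split_ifs at hji <;> omega
    rw [htop, hbot] at hxy
    obtain ⟨⟨x1, x2, x3⟩, ⟨y1, y2, y3⟩⟩ := hxy
    have hx : T ⟨_, hA⟩ ≤ T x := by
      rcases Nat.lt_or_ge b x.1.2.1 with h | h
      · exact (hrs ⟨_, hA⟩ x x2.symm x1.symm h).le
      · have : x = ⟨_, hA⟩ := Subtype.ext (Prod.ext x2 (Prod.ext (le_antisymm h x3) x1))
        rw [this]
    have hy : T y ≤ T ⟨_, hB⟩ := by
      rcases Nat.lt_or_ge y.1.2.1 b with h | h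
      · exact (hrs y ⟨_, hB⟩ y2 y1 h).le
      · have : y = ⟨_, hB⟩ := Subtype.ext (Prod.ext y2 (Prod.ext (le_antisymm y3 h) y1))
        rw [this]
    exact lt_of_le_of_lt hy (lt_of_lt_of_le hlt hx)
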